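/- Let ℝ³ = EuclideanSpace ℝ (Fin 3) and let S² be its unit sphere {v : ‖v‖ = 1}. Inside ℝ³ × S², the closure of the set {(x, v) : x ≠ 0 and (v = ‖x‖⁻¹ • x or v = −‖x‖⁻¹ • x)} is equal to the set {(x, v) : ∃ t ∈ ℝ, x = t • v} = ⋃_{v ∈ S²} (ℝ∙v) × {v}. -/

import Mathlib

open Metric in
/-- The set of pairs `(x, v)` with `v` a unit vector and `x` on the line spanned by `v` is
closed. -/
theorem isClosed_setOf_mem_line_sphere {E : Type*} [NormedAddCommGroup E]
    [InnerProductSpace ℝ E] :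
    IsClosed {p : E × sphere (0 : E) 1 | ∃ t : ℝ, p.1 = t • (p.2 : E)} := by
  have key : {p : E × sphere (0 : E) 1 | ∃ t : ℝ, p.1 = t • (p.2 : E)} =
      {p | p.1 = (inner ℝ (p.2 : E) p.1) • (p.2 : E)} := by
    ext ⟨x, v⟩
    refine ⟨?_, fun h => ⟨_, h⟩⟩
    rintro ⟨t, rfl : x = t • (v : E)⟩
    simp [inner_smul_right]
  rw [key]
  exact isClosed_eq (by fun_prop) (by fun_prop)

/-- A unit vector `v` is `±` the normalization of each nonzero multiple of itself. -/
theorem eq_or_eq_neg_normalize_smul {E : Type*} [NormedAddCommGroup E] [NormedSpace ℝ E]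
    {v : E} (hv : ‖v‖ = 1) {t : ℝ} (ht : t ≠ 0) :
    v = ‖t • v‖⁻¹ • (t • v) ∨ v = -(‖t • v‖⁻¹ • (t • v)) := by
  rw [norm_smul, hv, mul_one, Real.norm_eq_abs, smul_smul]
  rcases abs_choice t with h | h
  · left
    rw [h, inv_mul_cancel₀ ht, one_smul]
  · right
    rw [h, inv_neg, neg_mul, inv_mul_cancel₀ ht, neg_smul, one_smul, neg_neg]


/-- In `ℝ³ × S²`, the closure of `{(x,v) : x ≠ 0, v = ±x/‖x‖}` is the set
`{(x,v) : x ∈ ℝ∙v} = ⋃_{v ∈ S²} (ℝ∙v) × {v}`. -/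
theorem stmt_6 :
    closure {p : EuclideanSpace ℝ (Fin 3) × Metric.sphere (0 : EuclideanSpace ℝ (Fin 3)) 1 |
        p.1 ≠ 0 ∧ ((p.2 : EuclideanSpace ℝ (Fin 3)) = ‖p.1‖⁻¹ • p.1 ∨
          (p.2 : EuclideanSpace ℝ (Fin 3)) = -(‖p.1‖⁻¹ • p.1))} =
      {p : EuclideanSpace ℝ (Fin 3) × Metric.sphere (0 : EuclideanSpace ℝ (Fin 3)) 1 |
        ∃ t : ℝ, p.1 = t • (p.2 : EuclideanSpace ℝ (Fin 3))} := by
  refine (closure_minimal ?_ isClosed_setOf_mem_line_sphere).antisymm ?_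
  · rintro ⟨x, v⟩ ⟨hx, hv⟩
    have hx' : ‖x‖ ≠ 0 := norm_ne_zero_iff.mpr hx
    rcases hv with hv | hv
    · refine ⟨‖x‖, ?_⟩
      simp only at hv ⊢
      rw [hv, smul_inv_smul₀ hx']
    · refine ⟨-‖x‖, ?_⟩
      simp only at hv ⊢
      rw [hv, smul_neg, neg_smul, neg_neg, smul_inv_smul₀ hx']
  · rintro ⟨x, v⟩ ⟨t, rfl : x = t • (v : EuclideanSpace ℝ (Fin 3))⟩
    have hv : ‖(v : EuclideanSpace ℝ (Fin 3))‖ = 1 := norm_eq_of_mem_sphere v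
    refine map_mem_closure (f := fun s : ℝ => (s • (v : EuclideanSpace ℝ (Fin 3)), v))
      (by fun_prop) (dense_compl_singleton (0 : ℝ) t) fun s hs => ⟨?_, ?_⟩
    · exact smul_ne_zero hs (norm_ne_zero_iff.mp (hv.trans_ne one_ne_zero))
    · exact eq_or_eq_neg_normalize_smul hv hs
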